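/- Let υ be a positive integer, k ∈ ℕ, and let p, q be reals with q > −1 and p + q < 1. Let a > 0, b > 0, and w₁, w₂ be reals with w₂^υ ≠ b^υ. Then the double Laplace transform ∫_0^∞ ∫_0^∞ e^{−(a y + b z)} y^q z^{−p−q} · _K M_{k;υ}^{(p,q)}(w₁ y, w₂ z) dy dz converges and equals [Γ(k+q+1) / (a^{q+1} b^{1−p−q})] · ((w₂^υ − b^υ)/b^υ)^k · Σ_{l=0}^{k} [(−k)_l (k+1−p)_l / l!] · (w₁ b^υ/(a (w₂^υ − b^υ)))^l. -/

import Mathlib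

open Finset MeasureTheory

/-- Pochhammer symbol `(a)_n = a (a+1) ⋯ (a+n-1)` for real `a`. -/
noncomputable def poch (a : ℝ) (n : ℕ) : ℝ := (ascPochhammer ℝ n).eval a

/-- The finite bivariate M-Konhauser polynomial `_K M_{k;υ}^{(p,q)}(y,z)`. -/
noncomputable def MK (p q : ℝ) (υ k : ℕ) (y z : ℝ) : ℝ :=
  (-1 : ℝ) ^ k * Real.Gamma ((k : ℝ) + q + 1) *
    ∑ l ∈ range (k + 1), ∑ s ∈ range (k - l + 1),
      poch (-(k : ℝ)) (l + s) * poch ((k : ℝ) + 1 - p) l * (-y) ^ l * z ^ (υ * s) /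
        (Real.Gamma ((l : ℝ) + q + 1) * Real.Gamma ((υ : ℝ) * (s : ℝ) - p - q + 1) *
          (l.factorial : ℝ) * (s.factorial : ℝ))

lemma poch_neg_natCast (k n : ℕ) : poch (-(k : ℝ)) n = (-1) ^ n * (k.descFactorial n : ℝ) := by
  rw [poch, ascPochhammer_eval_neg_eq_descPochhammer, descPochhammer_eval_eq_descFactorial]

lemma poch_neg_natCast_add (k l s : ℕ) :
    poch (-(k : ℝ)) (l + s) =
      poch (-(k : ℝ)) l * ((-1) ^ s * (s.factorial : ℝ) * ((k - l).choose s : ℝ)) := by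
  have h := Nat.descFactorial_mul_descFactorial (n := k) (Nat.le_add_right l s)
  rw [Nat.add_sub_cancel_left, Nat.descFactorial_eq_factorial_mul_choose (k - l) s] at h
  rw [poch_neg_natCast, poch_neg_natCast, ← h]
  push_cast
  ring

/-- The terminating binomial series, shifted by `l`. -/
lemma sum_poch_neg_natCast_add_mul_pow (k l : ℕ) (x : ℝ) :
    ∑ s ∈ range (k - l + 1), poch (-(k : ℝ)) (l + s) * x ^ s / (s.factorial : ℝ) =
      poch (-(k : ℝ)) l * (1 - x) ^ (k - l) := by
  rw [sub_eq_neg_add, add_pow, mul_sum]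
  refine sum_congr rfl fun s _ => ?_
  have hs : (s.factorial : ℝ) ≠ 0 := by positivity
  rw [poch_neg_natCast_add, neg_pow x s, one_pow]
  field_simp

lemma exp_neg_mul_rpow_mul_pow_eq {y : ℝ} (hy : 0 < y) (a c : ℝ) (n : ℕ) :
    Real.exp (-(a * y)) * y ^ c * y ^ n = y ^ ((n + c + 1) - 1) * Real.exp (-(a * y)) := by
  rw [add_sub_cancel_right, Real.rpow_add hy, Real.rpow_natCast]
  ring

lemma integrableOn_exp_neg_mul_rpow_mul_pow {a c : ℝ} (ha : 0 < a) (hc : -1 < c) (n : ℕ) :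
    IntegrableOn (fun y : ℝ => Real.exp (-(a * y)) * y ^ c * y ^ n) (Set.Ioi 0) := by
  have hn : (0 : ℝ) ≤ n := n.cast_nonneg
  refine (integrableOn_rpow_mul_exp_neg_mul_rpow (s := n + c + 1 - 1) (p := 1) (by linarith)
    one_pos ha).congr_fun (fun y hy => ?_) measurableSet_Ioi
  simp only [exp_neg_mul_rpow_mul_pow_eq hy, Real.rpow_one, neg_mul]

lemma integral_exp_neg_mul_rpow_mul_pow {a c : ℝ} (ha : 0 < a) (hc : -1 < c) (n : ℕ) :
    ∫ y in Set.Ioi (0 : ℝ), Real.exp (-(a * y)) * y ^ c * y ^ n =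
      Real.Gamma (n + c + 1) / (a ^ (c + 1) * a ^ n) := by
  have hn : (0 : ℝ) ≤ n := n.cast_nonneg
  rw [setIntegral_congr_fun measurableSet_Ioi
      fun y hy => exp_neg_mul_rpow_mul_pow_eq hy a c n,
    Real.integral_rpow_mul_exp_neg_mul_Ioi (by linarith) ha, one_div, Real.inv_rpow ha.le,
    add_assoc, Real.rpow_add ha, Real.rpow_natCast]
  field_simp

/-- The integrand of the double Laplace transform as a finite sum of products of functions of one
variable. -/
lemma laplace_integrand_eq (υ k : ℕ) (p q a b w₁ w₂ y z : ℝ) :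
    Real.exp (-(a * y + b * z)) * y ^ q * z ^ (-p - q) * MK p q υ k (w₁ * y) (w₂ * z) =
      ∑ l ∈ range (k + 1), ∑ s ∈ range (k - l + 1),
        ((-1 : ℝ) ^ k * Real.Gamma ((k : ℝ) + q + 1) *
          (poch (-(k : ℝ)) (l + s) * poch ((k : ℝ) + 1 - p) l * (-w₁) ^ l * w₂ ^ (υ * s) /
            (Real.Gamma ((l : ℝ) + q + 1) * Real.Gamma ((υ : ℝ) * (s : ℝ) - p - q + 1) *
              (l.factorial : ℝ) * (s.factorial : ℝ)))) *
          ((Real.exp (-(a * y)) * y ^ q * y ^ l) *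
            (Real.exp (-(b * z)) * z ^ (-p - q) * z ^ (υ * s))) := by
  rw [MK, neg_add, Real.exp_add]
  simp only [mul_sum]
  refine sum_congr rfl fun l _ => sum_congr rfl fun s _ => ?_
  rw [← neg_mul w₁ y, mul_pow (-w₁), mul_pow w₂]
  ring

/-- Double Laplace transform of the finite bivariate M-Konhauser polynomials,
expressed as a terminating `₂F₀` series. -/
theorem MK_double_laplace (υ : ℕ) (hυ : 0 < υ) (k : ℕ) (p q : ℝ) (hq : q > -1)
    (hpq : p + q < 1) (a b w₁ w₂ : ℝ) (ha : 0 < a) (hb : 0 < b)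
    (hw : w₂ ^ υ ≠ b ^ υ) :
    IntegrableOn
      (fun yz : ℝ × ℝ =>
        Real.exp (-(a * yz.1 + b * yz.2)) * yz.1 ^ q * yz.2 ^ (-p - q) *
          MK p q υ k (w₁ * yz.1) (w₂ * yz.2))
      (Set.Ioi (0 : ℝ) ×ˢ Set.Ioi (0 : ℝ)) ∧
    (∫ y in Set.Ioi (0 : ℝ), ∫ z in Set.Ioi (0 : ℝ),
        Real.exp (-(a * y + b * z)) * y ^ q * z ^ (-p - q) * MK p q υ k (w₁ * y) (w₂ * z))
      = Real.Gamma ((k : ℝ) + q + 1) / (a ^ (q + 1) * b ^ (1 - p - q)) *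
          ((w₂ ^ υ - b ^ υ) / b ^ υ) ^ k *
          ∑ l ∈ range (k + 1),
            poch (-(k : ℝ)) l * poch ((k : ℝ) + 1 - p) l / (l.factorial : ℝ) *
              (w₁ * b ^ υ / (a * (w₂ ^ υ - b ^ υ))) ^ l := by
  have hq' : -1 < q := hq
  have hpq' : -1 < -p - q := by linarith
  have hterm (l s : ℕ) (C : ℝ) : IntegrableOn (fun yz : ℝ × ℝ =>
      C * ((Real.exp (-(a * yz.1)) * yz.1 ^ q * yz.1 ^ l) *
        (Real.exp (-(b * yz.2)) * yz.2 ^ (-p - q) * yz.2 ^ (υ * s))))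
      (Set.Ioi (0 : ℝ) ×ˢ Set.Ioi (0 : ℝ)) := by
    rw [IntegrableOn, Measure.volume_eq_prod, ← Measure.prod_restrict]
    exact (Integrable.mul_prod (integrableOn_exp_neg_mul_rpow_mul_pow ha hq' l)
      (integrableOn_exp_neg_mul_rpow_mul_pow hb hpq' (υ * s))).const_mul C
  have hint : IntegrableOn
      (fun yz : ℝ × ℝ =>
        Real.exp (-(a * yz.1 + b * yz.2)) * yz.1 ^ q * yz.2 ^ (-p - q) *
          MK p q υ k (w₁ * yz.1) (w₂ * yz.2))
      (Set.Ioi (0 : ℝ) ×ˢ Set.Ioi (0 : ℝ)) := by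
    simp only [laplace_integrand_eq]
    exact integrable_finsetSum _ fun l _ => integrable_finsetSum _ fun s _ => hterm l s _
  refine ⟨hint, ?_⟩
  rw [Measure.volume_eq_prod] at hint
  rw [← setIntegral_prod _ hint, ← Measure.volume_eq_prod]
  simp only [laplace_integrand_eq]
  rw [integral_finsetSum _ fun l _ => integrable_finsetSum _ fun s _ => hterm l s _, mul_sum]
  refine sum_congr rfl fun l hl => ?_
  obtain ⟨m, rfl⟩ := Nat.exists_eq_add_of_le (Nat.lt_succ_iff.mp (mem_range.mp hl))
  rw [integral_finsetSum _ fun s _ => hterm l s _]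
  have hbυ : b ^ υ ≠ 0 := by positivity
  have hw' : w₂ ^ υ - b ^ υ ≠ 0 := sub_ne_zero.mpr hw
  have hsum := sum_poch_neg_natCast_add_mul_pow (l + m) l (w₂ ^ υ / b ^ υ)
  have hbp : b ^ (1 - p - q) ≠ 0 := by positivity
  have haq : a ^ (q + 1) ≠ 0 := by positivity
  calc
    _ = ∑ s ∈ range (l + m - l + 1),
        ((-1 : ℝ) ^ (l + m) * Real.Gamma (((l + m : ℕ) : ℝ) + q + 1) *
          poch (((l + m : ℕ) : ℝ) + 1 - p) l * (-w₁) ^ l /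
            (l.factorial * a ^ (q + 1) * a ^ l * b ^ (1 - p - q))) *
          (poch (-((l + m : ℕ) : ℝ)) (l + s) * (w₂ ^ υ / b ^ υ) ^ s / (s.factorial : ℝ)) := by
      refine sum_congr rfl fun s _ => ?_
      have hl0 : (0 : ℝ) ≤ l := l.cast_nonneg
      have hs0 : (0 : ℝ) ≤ (υ : ℝ) * s := by positivity
      have hΓ₁ : Real.Gamma ((l : ℝ) + q + 1) ≠ 0 := (Real.Gamma_pos_of_pos (by linarith)).ne'
      have hΓ₂ : Real.Gamma ((υ : ℝ) * s - p - q + 1) ≠ 0 :=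
        (Real.Gamma_pos_of_pos (by linarith)).ne'
      rw [integral_const_mul, Measure.volume_eq_prod,
        setIntegral_prod_mul (fun y => Real.exp (-(a * y)) * y ^ q * y ^ l)
          (fun z => Real.exp (-(b * z)) * z ^ (-p - q) * z ^ (υ * s)),
        integral_exp_neg_mul_rpow_mul_pow ha hq', integral_exp_neg_mul_rpow_mul_pow hb hpq',
        show ((υ * s : ℕ) : ℝ) + (-p - q) + 1 = (υ : ℝ) * s - p - q + 1 by push_cast; ring,
        show -p - q + 1 = 1 - p - q by ring, div_pow, ← pow_mul, ← pow_mul]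
      field_simp
    _ = _ := by
      rw [← mul_sum, hsum, Nat.add_sub_cancel_left]
      have h1 : 1 - w₂ ^ υ / b ^ υ = -((w₂ ^ υ - b ^ υ) / b ^ υ) := by field_simp; ring
      have hsign (n : ℕ) : (-1 : ℝ) ^ n * (-1) ^ n = 1 := by rw [← mul_pow]; norm_num
      rw [h1, neg_pow w₁, neg_pow (_ / _) m, pow_add (-1 : ℝ), pow_add (_ / _) l m]
      set D := w₂ ^ υ - b ^ υ
      set G := Real.Gamma (((l + m : ℕ) : ℝ) + q + 1)
      have h2 : (D / b ^ υ) ^ l * (w₁ * b ^ υ / (a * D)) ^ l = w₁ ^ l / a ^ l := by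
        rw [← mul_pow, ← div_pow]; congr 1; field_simp
      have hR : G / (a ^ (q + 1) * b ^ (1 - p - q)) *
          ((D / b ^ υ) ^ l * (D / b ^ υ) ^ m) *
          (poch (-((l + m : ℕ) : ℝ)) l * poch (((l + m : ℕ) : ℝ) + 1 - p) l / l.factorial *
            (w₁ * b ^ υ / (a * D)) ^ l) =
          G / (a ^ (q + 1) * b ^ (1 - p - q)) * (D / b ^ υ) ^ m *
          (poch (-((l + m : ℕ) : ℝ)) l * poch (((l + m : ℕ) : ℝ) + 1 - p) l / l.factorial) *
            (w₁ ^ l / a ^ l) := by rw [← h2]; ring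
      rw [hR]
      generalize (D / b ^ υ) ^ m = X
      linear_combination (((-1) ^ l * (-1) ^ l) * hsign m + hsign l) *
        (G / (a ^ (q + 1) * b ^ (1 - p - q)) * X *
          (poch (-((l + m : ℕ) : ℝ)) l * poch (((l + m : ℕ) : ℝ) + 1 - p) l / l.factorial) *
            (w₁ ^ l / a ^ l))
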